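/- Improved constant: FB ≤ 8.23·max(SP, BuyerP). (This follows from the general λ-approximation theorem by taking λ = 0.311, since 1/(1 − λ) + 1/(λ·(1 − λ)²) ≤ 8.23 for this λ.) -/

import Mathlib

open MeasureTheory Set

lemma aux_supp (μ : Measure ℝ) [IsProbabilityMeasure μ] (F : ℝ → ℝ)
    (hF : ∀ x, F x = (μ (Iic x)).toReal) (hF0 : F 0 = 0) (hF1 : F 1 = 1) :
    ∀ᵐ v ∂μ, v ∈ Icc (0:ℝ) 1 := by
  have h0 : μ (Iic 0) = 0 := by
    have := hF 0
    rw [hF0] at this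
    exact (measureReal_eq_zero_iff (μ := μ) (s := Iic (0:ℝ))).1 this.symm
  have h1 : μ (Ioi 1) = 0 := by
    have h2 : μ (Iic 1) = 1 := by
      have := hF 1
      rw [hF1] at this
      exact (ENNReal.toReal_eq_one_iff _).1 this.symm
    have := (prob_compl_eq_zero_iff (μ := μ) (measurableSet_Iic (a := (1:ℝ)))).2 h2
    simpa using this
  have a0 : ∀ᵐ v ∂μ, v ∉ Iic (0:ℝ) := measure_eq_zero_iff_ae_notMem.1 h0
  have a1 : ∀ᵐ v ∂μ, v ∉ Ioi (1:ℝ) := measure_eq_zero_iff_ae_notMem.1 h1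
  filter_upwards [a0, a1] with v hv hv'
  simp at hv hv'
  exact ⟨hv.le, hv'⟩

lemma aux_restrict (μ : Measure ℝ) (h : ∀ᵐ v ∂μ, v ∈ Icc (0:ℝ) 1) :
    μ.restrict (Icc 0 1) = μ := Measure.restrict_eq_self_of_ae_mem h

lemma aux_Icc (μ : Measure ℝ) [IsProbabilityMeasure μ] (F : ℝ → ℝ)
    (hF : ∀ x, F x = (μ (Iic x)).toReal) (hc : ContinuousOn F (Icc 0 1))
    (hF0 : F 0 = 0) (hF1 : F 1 = 1) (a : ℝ) (ha : a ∈ Icc (0:ℝ) 1) :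
    μ.real (Icc a 1) = 1 - F a := by
  have hF' : ∀ x, F x = μ.real (Iic x) := hF
  have hD : ∀ y : ℝ, Ioc y 1 = Iic 1 \ Iic y := by
    intro y; ext z; simp [and_comm]
  have key : ∀ y, y < a → μ.real (Icc a 1) ≤ 1 - F y := by
    intro y hy
    have h1 : μ.real (Ioc y 1) = F 1 - F y := by
      rw [hF', hF', hD, measureReal_diff (Iic_subset_Iic.2 (hy.le.trans ha.2))
        measurableSet_Iic]
    rw [hF1] at h1
    rw [← h1]
    refine measureReal_mono ?_ (by finiteness)
    intro z hz
    exact ⟨hy.trans_le hz.1, hz.2⟩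
  have lower : 1 - F a ≤ μ.real (Icc a 1) := by
    have h1 : μ.real (Ioc a 1) = F 1 - F a := by
      rw [hF', hF', hD, measureReal_diff (Iic_subset_Iic.2 ha.2)
        measurableSet_Iic]
    rw [hF1] at h1
    rw [← h1]
    exact measureReal_mono Ioc_subset_Icc_self
  refine le_antisymm ?_ lower
  rcases eq_or_lt_of_le ha.1 with h0 | h0
  · rw [← h0, hF0, sub_zero]
    exact measureReal_le_one
  · have ht : Filter.Tendsto (fun y => 1 - F y) (nhdsWithin a (Ico 0 a)) (nhds (1 - F a)) := by
      apply Filter.Tendsto.const_sub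
      exact (hc a ha).mono_left (nhdsWithin_mono _ (fun z hz => ⟨hz.1, hz.2.le.trans ha.2⟩))
    have : (nhdsWithin a (Ico 0 a)).NeBot := by
      rw [← mem_closure_iff_nhdsWithin_neBot, closure_Ico h0.ne]
      exact ⟨h0.le, le_rfl⟩
    exact ge_of_tendsto ht (by
      filter_upwards [self_mem_nhdsWithin] with y hy using key y hy.2)

lemma aux_int (μ ν : Measure ℝ) [IsProbabilityMeasure μ] [IsProbabilityMeasure ν]
    (hμ : ∀ᵐ v ∂μ, v ∈ Icc (0:ℝ) 1) (hν : ∀ᵐ v ∂ν, v ∈ Icc (0:ℝ) 1)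
    (f : ℝ × ℝ → ℝ) (hf : Measurable f)
    (hb : ∀ p : ℝ × ℝ, p.1 ∈ Icc (0:ℝ) 1 → p.2 ∈ Icc (0:ℝ) 1 → |f p| ≤ 1) :
    Integrable f (ν.prod μ) := by
  apply Integrable.of_bound hf.aestronglyMeasurable 1
  have : (ν.prod μ) = (ν.prod μ).restrict (Icc 0 1 ×ˢ Icc 0 1) := by
    rw [← Measure.prod_restrict, aux_restrict _ hμ, aux_restrict _ hν]
  rw [this]
  filter_upwards [ae_restrict_mem (measurableSet_Icc.prod measurableSet_Icc)] with p hp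
  exact hb p hp.1 hp.2

lemma aux_x (μ : Measure ℝ) [IsProbabilityMeasure μ] (F : ℝ → ℝ)
    (hF : ∀ x, F x = (μ (Iic x)).toReal) (hc : ContinuousOn F (Icc 0 1))
    (hm : StrictMonoOn F (Icc 0 1))
    (hF0 : F 0 = 0) (hF1 : F 1 = 1) :
    ∃ x : ℝ → ℝ, Measurable x ∧ (∀ c, x c ∈ Icc (0:ℝ) 1) ∧
      (∀ c ∈ Icc (0:ℝ) 1, c ≤ x c) ∧
      (∀ c ∈ Icc (0:ℝ) 1, 2 * (1 - F (x c)) = 1 - F c) ∧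
      (∀ c ∈ Icc (0:ℝ) 1, (μ.restrict (Icc c 1)).map x = (2:ENNReal) • μ.restrict (Icc (x c) 1)) := by
  have hr : ∀ c ∈ Icc (0:ℝ) 1, 0 ≤ F c ∧ F c ≤ 1 := by
    intro c hc
    rw [← hF0, ← hF1]
    exact ⟨hm.monotoneOn ⟨le_rfl, zero_le_one⟩ hc hc.1, hm.monotoneOn hc ⟨zero_le_one, le_rfl⟩ hc.2⟩
  have ivt : ∀ y, 0 ≤ y → y ≤ 1 → ∃ z ∈ Icc (0:ℝ) 1, F z = y := by
    intro y h0 h1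
    have := intermediate_value_Icc zero_le_one hc
    rw [hF0, hF1] at this
    exact this ⟨h0, h1⟩
  have hcl : ∀ c : ℝ, (max 0 (min c 1)) ∈ Icc (0:ℝ) 1 := fun c =>
    ⟨le_max_left _ _, max_le zero_le_one (min_le_right _ _)⟩
  have hcl' : ∀ c ∈ Icc (0:ℝ) 1, max 0 (min c 1) = c := by
    intro c hc
    rw [min_eq_left hc.2, max_eq_right hc.1]
  have hex : ∀ c : ℝ, ∃ z ∈ Icc (0:ℝ) 1, F z = (1 + F (max 0 (min c 1))) / 2 := by
    intro c
    have := hr _ (hcl c)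
    exact ivt _ (by linarith) (by linarith)
  choose x hx hFx using hex
  have hFx' : ∀ c ∈ Icc (0:ℝ) 1, F (x c) = (1 + F c) / 2 := by
    intro c hc
    rw [hFx, hcl' c hc]
  have hmono : Monotone x := by
    intro a b hab
    rw [← hm.le_iff_le (hx a) (hx b), hFx, hFx]
    have := hm.monotoneOn (hcl a) (hcl b) (by gcongr)
    linarith
  have hle : ∀ a ∈ Icc (0:ℝ) 1, ∀ b ∈ Icc (0:ℝ) 1, (x a ≤ x b ↔ a ≤ b) := by
    intro a ha b hb
    rw [← hm.le_iff_le (hx a) (hx b), hFx' a ha, hFx' b hb, ← hm.le_iff_le ha hb]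
    constructor <;> intro h <;> linarith
  have hhalf : ∀ c ∈ Icc (0:ℝ) 1, 2 * (1 - F (x c)) = 1 - F c := by
    intro c hc
    rw [hFx' c hc]; ring
  have hmeas : ∀ c ∈ Icc (0:ℝ) 1, μ (Icc c 1) = 2 * μ (Icc (x c) 1) := by
    intro c hcc
    have h1 := aux_Icc μ F hF hc hF0 hF1 c hcc
    have h2 := aux_Icc μ F hF hc hF0 hF1 (x c) (hx c)
    rw [← ENNReal.toReal_eq_toReal_iff' (by finiteness) (by finiteness), ENNReal.toReal_mul]
    change μ.real _ = (2:ENNReal).toReal * μ.real _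
    rw [h1, h2, ← hhalf c hcc]
    simp
  refine ⟨x, hmono.measurable, hx, ?_, hhalf, ?_⟩
  · intro c hc
    rw [← hm.le_iff_le hc (hx c), hFx' c hc]
    linarith [(hr c hc).2]
  · intro c hcc
    apply Measure.ext_of_Ici
    intro t
    rw [Measure.map_apply hmono.measurable measurableSet_Ici,
      Measure.restrict_apply (hmono.measurable measurableSet_Ici), Measure.smul_apply,
      Measure.restrict_apply measurableSet_Ici, smul_eq_mul]
    rcases le_or_gt t (x c) with ht | ht
    · have e1 : x ⁻¹' Ici t ∩ Icc c 1 = Icc c 1 :=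
        inter_eq_right.2 (fun z hz => ht.trans (hmono hz.1))
      have e2 : Ici t ∩ Icc (x c) 1 = Icc (x c) 1 :=
        inter_eq_right.2 (fun z hz => ht.trans hz.1)
      rw [e1, e2]
      exact hmeas c hcc
    · rcases lt_or_ge 1 t with h1 | h1
      · have e1 : x ⁻¹' Ici t ∩ Icc c 1 = ∅ := by
          ext z
          simp only [mem_inter_iff, mem_preimage, mem_Ici, mem_empty_iff_false, iff_false]
          rintro ⟨h, -⟩
          linarith [(hx z).2]
        have e2 : Ici t ∩ Icc (x c) 1 = ∅ := by
          ext z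
          simp only [mem_inter_iff, mem_Icc, mem_Ici, mem_empty_iff_false, iff_false]
          rintro ⟨h, -, h'⟩
          linarith
        rw [e1, e2]; simp
      · have ht01 : t ∈ Icc (0:ℝ) 1 := ⟨(hx c).1.trans ht.le, h1⟩
        have hFt : F (x c) ≤ F t := hm.monotoneOn (hx c) ht01 ht.le
        rw [hFx' c hcc] at hFt
        obtain ⟨d, hd, hFd⟩ := ivt (2 * F t - 1) (by linarith [(hr c hcc).1])
          (by linarith [(hr t ht01).2])
        have hxd : x d = t := hm.injOn (hx d) ht01 (by rw [hFx' d hd, hFd]; ring)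
        subst hxd
        have hcd : c ≤ d := (hle c hcc d hd).1 ht.le
        have e1 : x ⁻¹' Ici (x d) ∩ Icc c 1 = Icc d 1 := by
          ext z
          simp only [mem_inter_iff, mem_preimage, mem_Ici, mem_Icc]
          constructor
          · rintro ⟨h, h2, h3⟩
            exact ⟨(hle d hd z ⟨hcc.1.trans h2, h3⟩).1 h, h3⟩
          · rintro ⟨h2, h3⟩
            exact ⟨hmono h2, hcd.trans h2, h3⟩
        have e2 : Ici (x d) ∩ Icc (x c) 1 = Icc (x d) 1 := by
          ext z
          simp only [mem_inter_iff, mem_Ici, mem_Icc]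
          constructor
          · rintro ⟨h, h2, h3⟩
            exact ⟨h, h3⟩
          · rintro ⟨h2, h3⟩
            exact ⟨h2, ht.le.trans h2, h3⟩
        rw [e1, e2]
        exact hmeas d hd

/-- double integral of a bounded measurable function over sections -/
lemma aux_sec (μ ν : Measure ℝ) [IsProbabilityMeasure μ] [IsProbabilityMeasure ν]
    (hμ : ∀ᵐ v ∂μ, v ∈ Icc (0:ℝ) 1) (hν : ∀ᵐ v ∂ν, v ∈ Icc (0:ℝ) 1)
    (a b : ℝ → ℝ) (ha : Measurable a) (hb : Measurable b) (g : ℝ × ℝ → ℝ) (hg : Measurable g)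
    (hbd : ∀ p : ℝ × ℝ, p.1 ∈ Icc (0:ℝ) 1 → p.2 ∈ Icc (0:ℝ) 1 → |g p| ≤ 1) :
    Integrable (fun p : ℝ × ℝ => (Icc (a p.1) (b p.1)).indicator (fun v => g (p.1, v)) p.2)
        (ν.prod μ) ∧
      Integrable (fun c => ∫ v in Icc (a c) (b c), g (c, v) ∂μ) ν := by
  have hS : MeasurableSet {p : ℝ × ℝ | a p.1 ≤ p.2 ∧ p.2 ≤ b p.1} :=
    (measurableSet_le (ha.comp measurable_fst) measurable_snd).inter
      (measurableSet_le measurable_snd (hb.comp measurable_fst))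
  have he : (fun p : ℝ × ℝ => (Icc (a p.1) (b p.1)).indicator (fun v => g (p.1, v)) p.2)
      = {p : ℝ × ℝ | a p.1 ≤ p.2 ∧ p.2 ≤ b p.1}.indicator g := by
    ext p
    by_cases h : a p.1 ≤ p.2 ∧ p.2 ≤ b p.1 <;> simp [indicator, h]
  have h1 : Integrable (fun p : ℝ × ℝ =>
      (Icc (a p.1) (b p.1)).indicator (fun v => g (p.1, v)) p.2) (ν.prod μ) := by
    apply aux_int μ ν hμ hν
    · rw [he]; exact hg.indicator hS
    · intro p h1 h2
      rw [indicator]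
      split_ifs
      · exact hbd p h1 h2
      · simp
  refine ⟨h1, ?_⟩
  have := h1.integral_prod_left
  refine this.congr (Filter.Eventually.of_forall fun c => ?_)
  exact integral_indicator (μ := μ) (f := fun v => g (c, v))
    (measurableSet_Icc (a := a c) (b := b c))

theorem stmt19
    (νF : Measure ℝ) [IsProbabilityMeasure νF]
    (F : ℝ → ℝ) (hFcdf : ∀ x, F x = (νF (Iic x)).toReal)
    (hFcont : ContinuousOn F (Icc 0 1))
    (hFmono : StrictMonoOn F (Icc 0 1))
    (hF0 : F 0 = 0) (hF1 : F 1 = 1)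
    (νG : Measure ℝ) [IsProbabilityMeasure νG]
    (G : ℝ → ℝ) (hGcdf : ∀ x, G x = (νG (Iic x)).toReal)
    (hGcont : ContinuousOn G (Icc 0 1))
    (hGmono : StrictMonoOn G (Icc 0 1))
    (hG0 : G 0 = 0) (hG1 : G 1 = 1)
    (r : ℝ → ℝ) (hrmeas : Measurable r)
    (hrmem : ∀ c ∈ Icc (0:ℝ) 1, r c ∈ Icc (0:ℝ) 1)
    (hrmax : ∀ c ∈ Icc (0:ℝ) 1, ∀ p ∈ Icc (0:ℝ) 1,
      (p - c) * (1 - F p) ≤ (r c - c) * (1 - F (r c)))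
    (r' : ℝ → ℝ) (hr'meas : Measurable r')
    (hr'mem : ∀ v ∈ Icc (0:ℝ) 1, r' v ∈ Icc (0:ℝ) 1)
    (hr'max : ∀ v ∈ Icc (0:ℝ) 1, ∀ p ∈ Icc (0:ℝ) 1,
      (v - p) * G p ≤ (v - r' v) * G (r' v))
    (FB SP BuyerP : ℝ)
    (hFB : FB = ∫ c in Icc (0:ℝ) 1, (∫ v in Icc c 1, (v - c) ∂νF) ∂νG)
    (hSP : SP = ∫ c in Icc (0:ℝ) 1, (∫ v in Icc (r c) 1, (v - c) ∂νF) ∂νG)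
    (hBuyerP : BuyerP = ∫ v in Icc (0:ℝ) 1, (∫ c in Icc 0 (r' v), (v - c) ∂νG) ∂νF)
    : FB ≤ 8.23 * max SP BuyerP := by
  have sF := aux_supp νF F hFcdf hF0 hF1
  have sG := aux_supp νG G hGcdf hG0 hG1
  rw [aux_restrict νG sG] at hFB hSP
  rw [aux_restrict νF sF] at hBuyerP
  obtain ⟨x, xmeas, xmem, xge, xhalf, xmap⟩ := aux_x νF F hFcdf hFcont hFmono hF0 hF1
  have mF := aux_Icc νF F hFcdf hFcont hF0 hF1
  have h1mem : (1:ℝ) ∈ Icc (0:ℝ) 1 := ⟨zero_le_one, le_rfl⟩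
  have h0mem : (0:ℝ) ∈ Icc (0:ℝ) 1 := ⟨le_rfl, zero_le_one⟩
  have iId : Integrable (fun v : ℝ => v) νF := by
    apply Integrable.of_bound measurable_id.aestronglyMeasurable 1
    filter_upwards [sF] with v hv
    rw [Real.norm_eq_abs, abs_le]
    exact ⟨le_trans (by norm_num) hv.1, hv.2⟩
  have iX : Integrable x νF := by
    apply Integrable.of_bound xmeas.aestronglyMeasurable 1
    filter_upwards with v
    rw [Real.norm_eq_abs, abs_le]
    exact ⟨by linarith [(xmem v).1], (xmem v).2⟩
  have iC : ∀ a : ℝ, Integrable (fun v : ℝ => v - a) νF := fun a => iId.sub (integrable_const a)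
  have iIdG : Integrable (fun v : ℝ => v) νG := by
    apply Integrable.of_bound measurable_id.aestronglyMeasurable 1
    filter_upwards [sG] with v hv
    rw [Real.norm_eq_abs, abs_le]
    exact ⟨le_trans (by norm_num) hv.1, hv.2⟩
  have iS := (aux_sec νF νG sF sG r (fun _ => 1) hrmeas measurable_const (fun p => p.2 - p.1)
    (measurable_snd.sub measurable_fst) (by
      intro p h1 h2
      rw [abs_le]; constructor <;> linarith [h1.1, h1.2, h2.1, h2.2])).2
  have iI := (aux_sec νF νG sF sG (fun c => c) (fun _ => 1) measurable_id measurable_const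
    (fun p => p.2 - p.1)
    (measurable_snd.sub measurable_fst) (by
      intro p h1 h2
      rw [abs_le]; constructor <;> linarith [h1.1, h1.2, h2.1, h2.2])).2
  have iB := (aux_sec νG νF sG sF (fun _ => 0) r' measurable_const hr'meas (fun p => p.1 - p.2)
    (measurable_fst.sub measurable_snd) (by
      intro p h1 h2
      rw [abs_le]; constructor <;> linarith [h1.1, h1.2, h2.1, h2.2])).2
  obtain ⟨iW2, iW⟩ := aux_sec νF νG sF sG (fun c => c) (fun _ => 1) measurable_id measurable_const
    (fun p => x p.2 - p.2)
    ((xmeas.comp measurable_snd).sub measurable_snd) (by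
      intro p h1 h2
      have := xmem p.2
      rw [abs_le]; constructor <;> linarith [h1.1, h1.2, h2.1, h2.2, this.1, this.2])
  simp only at iS iI iB iW iW2
  -- pointwise bounds on the seller side
  have pS : ∀ c ∈ Icc (0:ℝ) 1, (r c - c) * (1 - F (r c)) ≤ ∫ v in Icc (r c) 1, (v - c) ∂νF := by
    intro c hc
    rw [← mF _ (hrmem c hc), mul_comm, ← smul_eq_mul, ← setIntegral_const]
    apply setIntegral_mono_on (integrable_const _).integrableOn (iC c).integrableOn measurableSet_Icc
    intro v hv
    linarith [hv.1]
  have pT : ∀ c ∈ Icc (0:ℝ) 1, ∀ a, ∫ v in Icc (x c) 1, (v - a) ∂νF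
      = (∫ v in Icc (x c) 1, v ∂νF) - a * (1 - F (x c)) := by
    intro c hc a
    rw [integral_sub iId.integrableOn (integrable_const _).integrableOn, setIntegral_const,
      mF _ (xmem c), smul_eq_mul, mul_comm a]
  -- integral over [c,1] of a function below a plus truncated part
  have pU : ∀ c ∈ Icc (0:ℝ) 1, ∫ v in Icc c 1, (v - x c) ∂νF ≤ ∫ v in Icc (x c) 1, (v - x c) ∂νF := by
    intro c hc
    rw [← integral_indicator measurableSet_Icc, ← integral_indicator measurableSet_Icc]
    apply integral_mono ((iC _).indicator measurableSet_Icc) ((iC _).indicator measurableSet_Icc)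
    intro v
    have := xge c hc
    simp only [indicator, mem_Icc]
    split_ifs with h1 h2 h2
    · exact le_rfl
    · push Not at h2
      by_contra h3
      push Not at h3
      linarith [h2 (by linarith), h1.2]
    · exact absurd ⟨this.trans h2.1, h2.2⟩ h1
    · exact le_rfl
  have pV : ∀ c ∈ Icc (0:ℝ) 1, ∀ a, ∫ v in Icc c 1, (v - a) ∂νF
      = (∫ v in Icc c 1, v ∂νF) - a * (1 - F c) := by
    intro c hc a
    rw [integral_sub iId.integrableOn (integrable_const _).integrableOn, setIntegral_const,
      mF _ hc, smul_eq_mul, mul_comm a]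
  have pX : ∀ c ∈ Icc (0:ℝ) 1, ∫ s in Icc c 1, x s ∂νF = 2 * ∫ v in Icc (x c) 1, v ∂νF := by
    intro c hc
    have := integral_map (μ := νF.restrict (Icc c 1)) xmeas.aemeasurable
      (f := fun v => v) measurable_id.aestronglyMeasurable
    rw [← this, xmap c hc, integral_smul_measure]
    simp
  have main : ∀ c ∈ Icc (0:ℝ) 1, ∫ v in Icc c 1, (v - c) ∂νF
      ≤ 2 * (∫ v in Icc (r c) 1, (v - c) ∂νF) + ∫ s in Icc c 1, (x s - s) ∂νF := by
    intro c hc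
    have e1 := pU c hc
    rw [pT c hc, pV c hc] at e1
    have e2 := pV c hc c
    have e3 := pS c hc
    have e4 := hrmax c hc (x c) (xmem c)
    have e5 : ∫ s in Icc c 1, (x s - s) ∂νF
        = (∫ s in Icc c 1, x s ∂νF) - ∫ s in Icc c 1, s ∂νF :=
      integral_sub iX.integrableOn iId.integrableOn
    rw [e2, e5, pX c hc]
    have e6 := xhalf c hc
    rw [← e6] at e1 ⊢
    nlinarith
  have step1 : FB ≤ 2 * SP + ∫ c, (∫ s in Icc c 1, (x s - s) ∂νF) ∂νG := by
    rw [hFB, hSP, ← integral_const_mul, ← integral_add (iS.const_mul 2) iW]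
    apply integral_mono_ae iI ((iS.const_mul 2).add iW)
    filter_upwards [sG] with c hc using main c hc
  -- buyer side
  have pB : ∀ v ∈ Icc (0:ℝ) 1, (v - r' v) * G (r' v) ≤ ∫ c in Icc 0 (r' v), (v - c) ∂νG := by
    intro v hv
    have : G (r' v) = νG.real (Icc 0 (r' v)) := by
      rw [hGcdf]
      apply measureReal_congr
      filter_upwards [sG] with c hc
      apply propext
      exact ⟨fun h => ⟨hc.1, h⟩, fun h => h.2⟩
    rw [this, mul_comm, ← smul_eq_mul, ← setIntegral_const]
    apply setIntegral_mono_on (integrable_const _).integrableOn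
      ((integrable_const _).sub iIdG).integrableOn measurableSet_Icc
    intro c hc
    simp only [Pi.sub_apply]
    linarith [hc.2]
  have pB0 : ∀ v ∈ Icc (0:ℝ) 1, 0 ≤ ∫ c in Icc 0 (r' v), (v - c) ∂νG := by
    intro v hv
    have := hr'max v hv 0 h0mem
    rw [hG0, mul_zero] at this
    exact this.trans (pB v hv)
  have xm0 := xmap 0 h0mem
  rw [aux_restrict νF sF] at xm0
  have iBm : Integrable (fun v => ∫ c in Icc 0 (r' v), (v - c) ∂νG) (νF.map x) := by
    rw [xm0]
    exact iB.integrableOn.smul_measure (by simp)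
  have step2 : ∫ c, (∫ s in Icc c 1, (x s - s) ∂νF) ∂νG
      ≤ ∫ s, (∫ c in Icc 0 (r' (x s)), (x s - c) ∂νG) ∂νF := by
    have e : ∫ c, (∫ s in Icc c 1, (x s - s) ∂νF) ∂νG
        = ∫ c, (∫ s, (Icc c 1).indicator (fun s => x s - s) s ∂νF) ∂νG := by
      congr 1
      ext c
      exact (integral_indicator measurableSet_Icc).symm
    rw [e, integral_integral_swap iW2]
    apply integral_mono_ae iW2.integral_prod_right
      ((integrable_map_measure iBm.aestronglyMeasurable xmeas.aemeasurable).1 iBm)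
    filter_upwards [sF] with s hs
    have : ∫ c, (Icc c 1).indicator (fun s => x s - s) s ∂νG = (x s - s) * G s := by
      have e2 : (fun c => (Icc c 1).indicator (fun s => x s - s) s)
          = (Iic s).indicator (fun _ => x s - s) := by
        ext c
        simp [indicator, hs.2]
      rw [e2, integral_indicator measurableSet_Iic, setIntegral_const, hGcdf, smul_eq_mul, mul_comm]
      rfl
    simp only [this]
    exact (hr'max (x s) (xmem s) s hs).trans (pB (x s) (xmem s))
  have step3 : ∫ s, (∫ c in Icc 0 (r' (x s)), (x s - c) ∂νG) ∂νF ≤ 2 * BuyerP := by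
    have := integral_map (μ := νF) xmeas.aemeasurable iBm.aestronglyMeasurable
    rw [← this, xm0, integral_smul_measure, hBuyerP]
    have h := setIntegral_le_integral (s := Icc (x 0) 1) iB
      (by filter_upwards [sF] with v hv using pB0 v hv)
    simp only [ENNReal.toReal_ofNat, smul_eq_mul]
    linarith
  have bpos : 0 ≤ BuyerP := by
    rw [hBuyerP]
    apply integral_nonneg_of_ae
    filter_upwards [sF] with v hv using pB0 v hv
  have := le_max_left SP BuyerP
  have := le_max_right SP BuyerP
  norm_num
  linarith
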